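/- Let φ and ψ be anisotropic diagonal quasilinear p-forms over F such that φ and ψ are weakly Vishik equivalent. Then: (i) if φ is minimal over F, then ψ is minimal over F; (ii) if φ is a quasi-Pfister form, or a quasi-Pfister neighbor of codimension one of some anisotropic quasi-Pfister form over F, then φ and ψ are similar. -/

import Mathlib

/-!
Diagonal quasilinear `p`-forms over a field `F` of characteristic `p`,
following Hoffmann and Zemková. A form of dimension `n` is recorded by its
coefficient tuple `a : ι → F` (for a finite index type `ι`), the form being
`x ↦ ∑ i, a i * (x i)^p`.
-/

universe u

namespace QLF

open scoped BigOperators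

/-- Evaluation of the diagonal quasilinear `p`-form with coefficients `a` at `x`. -/
def eval (p : ℕ) {F : Type*} [CommRing F] {ι : Type*} [Fintype ι]
    (a : ι → F) (x : ι → F) : F :=
  ∑ i, a i * x i ^ p

/-- A form is isotropic if it has a nontrivial zero. -/
def Isotropic (p : ℕ) {F : Type*} [CommRing F] {ι : Type*} [Fintype ι] (a : ι → F) : Prop :=
  ∃ x : ι → F, x ≠ 0 ∧ eval p a x = 0

/-- A form is anisotropic if it has no nontrivial zero. -/
def Anisotropic (p : ℕ) {F : Type*} [CommRing F] {ι : Type*} [Fintype ι] (a : ι → F) : Prop :=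
  ¬ Isotropic p a

/-- In characteristic `p`, the zero set of a diagonal quasilinear `p`-form is a
linear subspace. -/
def zeroSubmodule (p : ℕ) [Fact p.Prime] {F : Type*} [Field F] [CharP F p]
    {ι : Type*} [Fintype ι] (a : ι → F) : Submodule F (ι → F) where
  carrier := {x | eval p a x = 0}
  zero_mem' := by
    have hp : p ≠ 0 := (Fact.out : p.Prime).ne_zero
    simp [eval, zero_pow hp]
  add_mem' := by
    intro x y hx hy
    haveI : ExpChar F p := .prime Fact.out
    have hxy : eval p a (x + y) = eval p a x + eval p a y := by
      simp only [eval, Pi.add_apply]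
      rw [← Finset.sum_add_distrib]
      exact Finset.sum_congr rfl fun i _ => by rw [add_pow_char, mul_add]
    simp only [Set.mem_setOf_eq] at *
    rw [hxy, hx, hy, add_zero]
  smul_mem' := by
    intro c x hx
    simp only [Set.mem_setOf_eq] at *
    have hcx : eval p a (c • x) = c ^ p * eval p a x := by
      simp only [eval, Pi.smul_apply, smul_eq_mul, Finset.mul_sum]
      exact Finset.sum_congr rfl fun i _ => by rw [mul_pow]; ring
    rw [hcx, hx, mul_zero]

/-- The defect `i₀` of a form: the dimension of its zero set. -/
noncomputable def defect (p : ℕ) [Fact p.Prime] {F : Type*} [Field F] [CharP F p]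
    {ι : Type*} [Fintype ι] (a : ι → F) : ℕ :=
  Module.finrank F (zeroSubmodule p a)

/-- Isometry of forms: a linear bijection carrying one form into the other. -/
def Isometric (p : ℕ) {F : Type*} [Field F] {ι κ : Type*} [Fintype ι] [Fintype κ]
    (a : ι → F) (b : κ → F) : Prop :=
  ∃ T : (ι → F) ≃ₗ[F] (κ → F), ∀ x, eval p a x = eval p b (T x)

/-- `a` is a subform of `b`. -/
def Subform (p : ℕ) {F : Type*} [Field F] {ι κ : Type*} [Fintype ι] [Fintype κ]
    (a : ι → F) (b : κ → F) : Prop :=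
  ∃ T : (ι → F) →ₗ[F] (κ → F), Function.Injective T ∧ ∀ x, eval p a x = eval p b (T x)

/-- Similarity of forms: `a ≃ c·b` for some scalar `c ≠ 0`. -/
def Similar (p : ℕ) {F : Type*} [Field F] {ι κ : Type*} [Fintype ι] [Fintype κ]
    (a : ι → F) (b : κ → F) : Prop :=
  ∃ c : F, c ≠ 0 ∧ Isometric p a (fun i => c * b i)

/-- Vishik equivalence: same dimension, and equal defects over every field
extension `E/F`. -/
def VishikEquiv (p : ℕ) [Fact p.Prime] {F : Type u} [Field F] [CharP F p]
    {ι κ : Type*} [Fintype ι] [Fintype κ] (a : ι → F) (b : κ → F) : Prop :=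
  Fintype.card ι = Fintype.card κ ∧
    ∀ (E : Type u) [Field E] [CharP E p] (f : F →+* E),
      defect p (f ∘ a) = defect p (f ∘ b)

/-- Weak Vishik equivalence: same dimension, and equal defects over every field
extension of the shape `E = F(α)` with `αᵖ ∈ F` (this includes `E = F`). -/
def WeakVishikEquiv (p : ℕ) [Fact p.Prime] {F : Type u} [Field F] [CharP F p]
    {ι κ : Type*} [Fintype ι] [Fintype κ] (a : ι → F) (b : κ → F) : Prop :=
  Fintype.card ι = Fintype.card κ ∧
    ∀ (E : Type u) [Field E] [CharP E p] (f : F →+* E) (α : E),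
      α ^ p ∈ Set.range ⇑f →
      Subfield.closure (insert α (Set.range ⇑f)) = ⊤ →
      defect p (f ∘ a) = defect p (f ∘ b)

/-- The set `Fᵖ` of `p`-th powers. -/
def pSet (p : ℕ) (F : Type*) [Field F] : Set F := Set.range fun x : F => x ^ p

/-- The subfield `Fᵖ` of `p`-th powers (in characteristic `p` the set of `p`-th
powers is already a subfield, so the closure adds nothing). -/
def pthSubfield (p : ℕ) (F : Type*) [Field F] : Subfield F :=
  Subfield.closure (pSet p F)

/-- The subfield `Fᵖ(s)` generated by a set `s` over `Fᵖ`. -/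
def adjoin (p : ℕ) {F : Type*} [Field F] (s : Set F) : Subfield F :=
  Subfield.closure (pSet p F ∪ s)

/-- The degree `[N : k]` of a subfield `N` over a subfield `k` (for `k ≤ N`,
the `k`-span of `N` in `F` is `N` itself, so this is the `k`-dimension of `N`). -/
noncomputable def degOver {F : Type*} [Field F] (k : Subfield F) (N : Subfield F) : ℕ :=
  Module.finrank k (Submodule.span k (N : Set F))

/-- The set `D_F(φ)` of values of the form. -/
def values (p : ℕ) {F : Type*} [CommRing F] {ι : Type*} [Fintype ι] (a : ι → F) : Set F :=
  Set.range (eval p a)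

/-- The norm field `N_F(φ)`: the subfield generated over `Fᵖ` by all quotients
of nonzero values of `φ`. -/
def normField (p : ℕ) {F : Type*} [Field F] {ι : Type*} [Fintype ι] (a : ι → F) : Subfield F :=
  adjoin p {z : F | ∃ u ∈ values p a, ∃ v ∈ values p a, u ≠ 0 ∧ v ≠ 0 ∧ z = u / v}

/-- The norm degree `ndeg_F(φ) = [N_F(φ) : Fᵖ]`. -/
noncomputable def ndeg (p : ℕ) {F : Type*} [Field F] {ι : Type*} [Fintype ι] (a : ι → F) : ℕ :=
  degOver (pthSubfield p F) (normField p a)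

/-- An anisotropic form is minimal if `ndeg_F(φ) = p^(dim φ - 1)`. -/
def Minimal (p : ℕ) {F : Type*} [Field F] {ι : Type*} [Fintype ι] (a : ι → F) : Prop :=
  Anisotropic p a ∧ ndeg p a = p ^ (Fintype.card ι - 1)

/-- The quasi-Pfister form `⟪b₁,…,bₙ⟫`: its coefficients are all products
`b₁^{e₁}⋯bₙ^{eₙ}` with `0 ≤ eᵢ ≤ p-1`. -/
def pfister (p : ℕ) {F : Type*} [CommRing F] {n : ℕ} (b : Fin n → F) :
    (Fin n → Fin p) → F :=
  fun e => ∏ i, b i ^ (e i : ℕ)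

/-- A form is a quasi-Pfister form if it is isometric to some `⟪b₁,…,bₙ⟫`
with all `bᵢ ∈ F×`. -/
def IsQuasiPfister (p : ℕ) {F : Type*} [Field F] {ι : Type*} [Fintype ι] (a : ι → F) : Prop :=
  ∃ (n : ℕ) (b : Fin n → F), (∀ i, b i ≠ 0) ∧ Isometric p a (pfister p b)

/-- `a` is a quasi-Pfister neighbor of the form `π`: `c·a ⊆ π` for some `c ≠ 0`
and `p · dim a > dim π`. -/
def IsNeighborOf (p : ℕ) {F : Type*} [Field F] {ι κ : Type*} [Fintype ι] [Fintype κ]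
    (a : ι → F) (π : κ → F) : Prop :=
  ∃ c : F, c ≠ 0 ∧ Subform p (fun i => c * a i) π ∧ p * Fintype.card ι > Fintype.card κ

/-- `a` is a quasi-Pfister neighbor (of some quasi-Pfister form). -/
def IsQPNeighbor (p : ℕ) {F : Type*} [Field F] {ι : Type*} [Fintype ι] (a : ι → F) : Prop :=
  ∃ (n : ℕ) (b : Fin n → F), (∀ i, b i ≠ 0) ∧ IsNeighborOf p a (pfister p b)

/-- `a` is a quasi-Pfister neighbor of codimension one of some anisotropic
quasi-Pfister form: `dim π - dim a = 1`. -/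
def IsQPNeighborCodimOne (p : ℕ) {F : Type*} [Field F] {ι : Type*} [Fintype ι]
    (a : ι → F) : Prop :=
  ∃ (n : ℕ) (b : Fin n → F), (∀ i, b i ≠ 0) ∧ Anisotropic p (pfister p b) ∧
    IsNeighborOf p a (pfister p b) ∧ Fintype.card ι + 1 = p ^ n

/-- Tensor product of diagonal forms: coefficients `aᵢ · bⱼ`. -/
def tensor (p : ℕ) {F : Type*} [CommRing F] {ι κ : Type*}
    (a : ι → F) (b : κ → F) : ι × κ → F :=
  fun ik => a ik.1 * b ik.2

/-- The set `G_F(φ) = {x ∈ F× : xφ ≃ φ} ∪ {0}` of similarity factors. -/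
def simFactors (p : ℕ) {F : Type*} [Field F] {ι : Type*} [Fintype ι] (a : ι → F) : Set F :=
  {x | x ≠ 0 ∧ Isometric p (fun i => x * a i) a} ∪ {0}

/-- `b` is the anisotropic part of `a`: `b` is anisotropic and
`a ≃ b ⊥ (m × ⟨0⟩)` for some `m`. -/
def IsAnisotropicPart (p : ℕ) {F : Type*} [Field F] {ι κ : Type*} [Fintype ι] [Fintype κ]
    (a : ι → F) (b : κ → F) : Prop :=
  Anisotropic p b ∧ ∃ m : ℕ, Isometric p a (Sum.elim b fun _ : Fin m => (0 : F))

/-- `⟪c₁,…,cₘ⟫` is (a representative of) the norm form of `a`: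
`N_F(a) = Fᵖ(c₁,…,cₘ)` and `ndeg_F(a) = pᵐ`. -/
def IsNormForm (p : ℕ) {F : Type*} [Field F] {ι : Type*} [Fintype ι] (a : ι → F)
    {m : ℕ} (c : Fin m → F) : Prop :=
  normField p a = adjoin p (Set.range c) ∧ ndeg p a = p ^ m

end QLF

namespace QLF

section

variable {p : ℕ} {F : Type u} [Field F] {ι κ : Type*} [Fintype ι] [Fintype κ]

theorem eval_smul (a : ι → F) (c : F) (x : ι → F) : eval p a (c • x) = c ^ p * eval p a x := by
  simp only [eval, Pi.smul_apply, smul_eq_mul, Finset.mul_sum]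
  exact Finset.sum_congr rfl fun i _ => by rw [mul_pow]; ring

theorem eval_mul_left (c : F) (a x : ι → F) :
    eval p (fun i => c * a i) x = c * eval p a x := by
  simp only [eval, Finset.mul_sum, mul_assoc]

theorem Anisotropic.eq_zero {a x : ι → F} (ha : Anisotropic p a) (h : eval p a x = 0) :
    x = 0 := by
  by_contra hx
  exact ha ⟨x, hx, h⟩

theorem Anisotropic.mul_left {a : ι → F} (ha : Anisotropic p a) {c : F} (hc : c ≠ 0) :
    Anisotropic p fun i => c * a i := by
  rintro ⟨x, hx, h⟩
  rw [eval_mul_left] at h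
  exact ha ⟨x, hx, (mul_eq_zero.1 h).resolve_left hc⟩

theorem Isometric.values_eq {a : ι → F} {b : κ → F} (h : Isometric p a b) :
    values p a = values p b := by
  obtain ⟨T, hT⟩ := h
  ext z
  constructor
  · rintro ⟨x, rfl⟩
    exact ⟨T x, (hT x).symm⟩
  · rintro ⟨y, rfl⟩
    exact ⟨T.symm y, by rw [hT, T.apply_symm_apply]⟩

theorem pow_mem_adjoin (s : Set F) (x : F) : x ^ p ∈ adjoin p s :=
  Subfield.subset_closure (Or.inl ⟨x, rfl⟩)

end

section

variable {p : ℕ} [Fact p.Prime] {F : Type u} [Field F] [CharP F p]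
  {ι κ : Type*} [Fintype ι] [Fintype κ]

theorem mem_pthSubfield {x : F} : x ∈ pthSubfield p F ↔ ∃ y, y ^ p = x := by
  have : ExpChar F p := .prime Fact.out
  have : pthSubfield p F = (frobenius F p).fieldRange := by
    apply le_antisymm
    · refine Subfield.closure_le.2 ?_
      rintro _ ⟨y, rfl⟩
      exact ⟨y, rfl⟩
    · rintro _ ⟨y, rfl⟩
      exact Subfield.subset_closure ⟨y, rfl⟩
  rw [this]
  rfl

theorem pow_mem_pthSubfield (x : F) : x ^ p ∈ pthSubfield p F := mem_pthSubfield.2 ⟨x, rfl⟩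

variable (p) in
/-- The value set of a form, as a vector space over `Fᵖ`. -/
def valueSpace (a : ι → F) : Submodule (pthSubfield p F) F :=
  Submodule.span _ (Set.range a)

theorem coe_valueSpace (a : ι → F) : (valueSpace p a : Set F) = values p a := by
  ext x
  simp only [valueSpace, SetLike.mem_coe, Submodule.mem_span_range_iff_exists_fun, values,
    Set.mem_range, eval]
  constructor
  · rintro ⟨c, rfl⟩
    choose y hy using fun i => mem_pthSubfield.1 (c i).2
    exact ⟨y, Finset.sum_congr rfl fun i _ => by rw [hy, mul_comm]; rfl⟩
  · rintro ⟨y, rfl⟩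
    exact ⟨fun i => ⟨y i ^ p, pow_mem_pthSubfield _⟩,
      Finset.sum_congr rfl fun i _ => mul_comm _ _⟩

theorem mem_valueSpace {a : ι → F} {x : F} : x ∈ valueSpace p a ↔ ∃ y, eval p a y = x := by
  rw [← SetLike.mem_coe, coe_valueSpace]
  rfl

theorem eval_add (a x y : ι → F) : eval p a (x + y) = eval p a x + eval p a y := by
  have : ExpChar F p := .prime Fact.out
  simp only [eval, Pi.add_apply]
  rw [← Finset.sum_add_distrib]
  exact Finset.sum_congr rfl fun i _ => by rw [add_pow_char, mul_add]

theorem Anisotropic.eval_injective {a : ι → F} (ha : Anisotropic p a) :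
    Function.Injective (eval p a) := by
  intro x y hxy
  have h := eval_add (p := p) a (x - y) y
  rw [sub_add_cancel, hxy] at h
  exact sub_eq_zero.1 (ha.eq_zero (right_eq_add.1 h))

theorem Anisotropic.finrank_valueSpace {a : ι → F} (ha : Anisotropic p a) :
    Module.finrank (pthSubfield p F) (valueSpace p a) = Fintype.card ι := by
  refine finrank_span_eq_card (Fintype.linearIndependent_iff.2 fun g hg i => ?_)
  choose y hy using fun i => mem_pthSubfield.1 (g i).2
  have h0 : eval p a y = 0 := by
    rw [← hg]
    exact Finset.sum_congr rfl fun i _ => by rw [hy, mul_comm]; rfl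
  have := congrFun (ha.eq_zero h0) i
  apply Subtype.ext
  rw [← hy, this]
  exact zero_pow (Fact.out : p.Prime).ne_zero

theorem isometric_of_values_eq {a : ι → F} {b : κ → F} (ha : Anisotropic p a)
    (hb : Anisotropic p b) (h : values p a = values p b) : Isometric p a b := by
  have h1 : ∀ x, ∃ y, eval p b y = eval p a x := fun x => by
    have : eval p a x ∈ values p b := h ▸ ⟨x, rfl⟩
    exact this
  choose T hT using h1
  let T' : (ι → F) →ₗ[F] (κ → F) :=
    { toFun := T
      map_add' := fun x y => hb.eval_injective (by rw [eval_add]; simp only [hT, eval_add])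
      map_smul' := fun c x => hb.eval_injective (by
        rw [RingHom.id_apply, eval_smul]; simp only [hT, eval_smul]) }
  refine ⟨LinearEquiv.ofBijective T' ⟨fun x y hxy => ha.eval_injective ?_, fun y => ?_⟩,
    fun x => (hT x).symm⟩
  · rw [← hT x, ← hT y]
    exact congrArg _ hxy
  · have : eval p b y ∈ values p a := h ▸ ⟨y, rfl⟩
    obtain ⟨x, hx⟩ := this
    exact ⟨x, hb.eval_injective ((hT x).trans hx)⟩

theorem similar_of_valueSpace {a : ι → F} {b : κ → F} (ha : Anisotropic p a)
    (hb : Anisotropic p b) {c : F} (hc : c ≠ 0)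
    (h : ∀ x, x ∈ valueSpace p a ↔ c⁻¹ * x ∈ valueSpace p b) : Similar p a b := by
  refine ⟨c, hc, isometric_of_values_eq ha (hb.mul_left hc) ?_⟩
  ext x
  rw [← coe_valueSpace, SetLike.mem_coe, h, mem_valueSpace]
  simp only [values, Set.mem_range, eval_mul_left]
  exact exists_congr fun y => by rw [eq_inv_mul_iff_mul_eq₀ hc]

theorem pfister_mul_mem {n : ℕ} (b : Fin n → F) (e e' : Fin n → Fin p) :
    pfister p b e * pfister p b e' ∈ valueSpace p (pfister p b) := by
  have hp : 0 < p := (Fact.out : p.Prime).pos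
  have key : pfister p b e * pfister p b e' =
      (⟨(∏ i, b i ^ (((e i : ℕ) + e' i) / p)) ^ p, pow_mem_pthSubfield _⟩ : pthSubfield p F) •
        pfister p b (fun i => ⟨((e i : ℕ) + e' i) % p, Nat.mod_lt _ hp⟩) := by
    change _ = (∏ i, b i ^ (((e i : ℕ) + e' i) / p)) ^ p * _
    simp only [pfister]
    rw [← Finset.prod_mul_distrib, ← Finset.prod_pow, ← Finset.prod_mul_distrib]
    refine Finset.prod_congr rfl fun i _ => ?_
    rw [← pow_mul, ← pow_add, ← pow_add, Nat.div_add_mod']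
  rw [key]
  exact Submodule.smul_mem _ _ (Submodule.subset_span ⟨_, rfl⟩)

theorem one_mem_valueSpace_pfister {n : ℕ} (b : Fin n → F) :
    (1 : F) ∈ valueSpace p (pfister p b) :=
  Submodule.subset_span ⟨fun _ => ⟨0, (Fact.out : p.Prime).pos⟩, by simp [pfister]⟩

theorem mul_mem_valueSpace_pfister {n : ℕ} (b : Fin n → F) {x y : F}
    (hx : x ∈ valueSpace p (pfister p b)) (hy : y ∈ valueSpace p (pfister p b)) :
    x * y ∈ valueSpace p (pfister p b) := by
  induction hx, hy using Submodule.span_induction₂ with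
  | mem_mem x y hx hy =>
    obtain ⟨e, rfl⟩ := hx
    obtain ⟨e', rfl⟩ := hy
    exact pfister_mul_mem b e e'
  | zero_left y _ => rw [zero_mul]; exact zero_mem _
  | zero_right x _ => rw [mul_zero]; exact zero_mem _
  | add_left x y z _ _ _ h1 h2 => rw [add_mul]; exact add_mem h1 h2
  | add_right x y z _ _ _ h1 h2 => rw [mul_add]; exact add_mem h1 h2
  | smul_left r x y _ _ h => rw [smul_mul_assoc]; exact Submodule.smul_mem _ _ h
  | smul_right r x y _ _ h => rw [mul_smul_comm]; exact Submodule.smul_mem _ _ h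

variable (p) in
/-- The values of a quasi-Pfister form are an intermediate field of `F / Fᵖ`. -/
def pfisterField {n : ℕ} (b : Fin n → F) : IntermediateField (pthSubfield p F) F where
  carrier := valueSpace p (pfister p b)
  mul_mem' := mul_mem_valueSpace_pfister b
  one_mem' := one_mem_valueSpace_pfister b
  add_mem' := add_mem
  zero_mem' := zero_mem _
  algebraMap_mem' r := by
    rw [Algebra.algebraMap_eq_smul_one]
    exact Submodule.smul_mem _ _ (one_mem_valueSpace_pfister b)
  inv_mem' x hx := by
    have hp := (Fact.out : p.Prime)
    rcases eq_or_ne x 0 with rfl | h0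
    · simp
    have hpow : ∀ k : ℕ, x ^ k ∈ valueSpace p (pfister p b) := fun k => by
      induction k with
      | zero => rw [pow_zero]; exact one_mem_valueSpace_pfister b
      | succ k ih => rw [pow_succ]; exact mul_mem_valueSpace_pfister b ih hx
    have key : x⁻¹ = (⟨(x⁻¹) ^ p, pow_mem_pthSubfield _⟩ : pthSubfield p F) • x ^ (p - 1) := by
      change _ = (x⁻¹) ^ p * x ^ (p - 1)
      obtain ⟨k, rfl⟩ : ∃ k, p = k + 1 := ⟨p - 1, (Nat.sub_add_cancel hp.one_le).symm⟩
      rw [Nat.add_sub_cancel, pow_succ', mul_assoc, ← mul_pow, inv_mul_cancel₀ h0, one_pow,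
        mul_one]
    rw [key]
    exact Submodule.smul_mem _ _ (hpow _)

theorem mem_pfisterField {n : ℕ} {b : Fin n → F} {x : F} :
    x ∈ pfisterField p b ↔ x ∈ valueSpace p (pfister p b) := Iff.rfl

theorem pow_mem_intermediateField (L : IntermediateField (pthSubfield p F) F) (x : F) :
    x ^ p ∈ L := L.algebraMap_mem ⟨x ^ p, pow_mem_pthSubfield x⟩

theorem adjoin_le {s : Set F} {L : IntermediateField (pthSubfield p F) F} (h : s ⊆ L) :
    adjoin p s ≤ L.toSubfield := by
  refine Subfield.closure_le.2 (Set.union_subset ?_ h)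
  rintro _ ⟨x, rfl⟩
  exact pow_mem_intermediateField L x

variable (p) in
/-- The norm field as an intermediate field of `F / Fᵖ`. -/
def normIntermediateField (a : ι → F) : IntermediateField (pthSubfield p F) F :=
  (normField p a).toIntermediateField fun x => by
    obtain ⟨y, hy⟩ := mem_pthSubfield.1 x.2
    change (x : F) ∈ normField p a
    exact hy ▸ pow_mem_adjoin _ y

theorem mem_normIntermediateField {a : ι → F} {x : F} :
    x ∈ normIntermediateField p a ↔ x ∈ normField p a := Iff.rfl

theorem div_mem_normField {a : ι → F} {u v : F} (hu : u ∈ valueSpace p a)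
    (hv : v ∈ valueSpace p a) : u / v ∈ normField p a := by
  rcases eq_or_ne u 0 with rfl | hu0
  · rw [zero_div]; exact zero_mem _
  rcases eq_or_ne v 0 with rfl | hv0
  · rw [div_zero]; exact zero_mem _
  exact Subfield.subset_closure
    (Or.inr ⟨u, mem_valueSpace.1 hu, v, mem_valueSpace.1 hv, hu0, hv0, rfl⟩)

theorem normField_le {a : ι → F} {L : IntermediateField (pthSubfield p F) F}
    (h : ∀ u ∈ valueSpace p a, ∀ v ∈ valueSpace p a, u ≠ 0 → v ≠ 0 → u / v ∈ L) :
    normIntermediateField p a ≤ L := by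
  refine adjoin_le ?_
  rintro _ ⟨u, hu, v, hv, hu0, hv0, rfl⟩
  exact h u (mem_valueSpace.2 hu) v (mem_valueSpace.2 hv) hu0 hv0

theorem linearIndependent_pow_of_notMem {N : IntermediateField (pthSubfield p F) F} {z : F}
    (hz : z ∉ N) : LinearIndependent N fun j : Fin p => z ^ (j : ℕ) := by
  have : ExpChar F p := .prime Fact.out
  have hp : p.Prime := Fact.out
  have hirr : Irreducible (Polynomial.X ^ p -
      Polynomial.C (⟨z ^ p, pow_mem_intermediateField N z⟩ : N)) := by
    refine X_pow_sub_C_irreducible_of_prime hp fun b hb => hz ?_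
    have : (b : F) ^ p = z ^ p := congrArg Subtype.val hb
    rw [← frobenius_inj F p this]
    exact b.2
  have hmin := minpoly.eq_of_irreducible_of_monic hirr (x := z) (by
    rw [map_sub, map_pow, Polynomial.aeval_X, Polynomial.aeval_C]
    exact sub_self _) (Polynomial.monic_X_pow_sub_C _ hp.ne_zero)
  have hdeg : (minpoly N z).natDegree = p := by
    rw [← hmin, Polynomial.natDegree_X_pow_sub_C]
  have hli := linearIndependent_pow (K := N) z
  rw [hdeg] at hli
  exact hli

variable (p) in
/-- `F(z^{1/p})`, realised through the Frobenius as the subfield `Fᵖ(z)` of `F`. -/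
def rootHom (z : F) : F →+* adjoin p ({z} : Set F) :=
  have : ExpChar F p := .prime Fact.out
  (frobenius F p).codRestrict _ fun x => pow_mem_adjoin _ x

theorem coe_rootHom (z x : F) : (rootHom p z x : F) = x ^ p := rfl

theorem mem_zeroSubmodule_rootHom {z : F} {a : ι → F} {e : ι → adjoin p ({z} : Set F)} :
    e ∈ zeroSubmodule p (rootHom p z ∘ a) ↔ ∑ i, a i * (e i : F) = 0 := by
  have : ExpChar F p := .prime Fact.out
  change eval p (rootHom p z ∘ a) e = 0 ↔ _
  rw [← Subtype.coe_inj]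
  simp only [eval, Function.comp_apply, AddSubmonoidClass.coe_finsetSum, MulMemClass.coe_mul,
    SubmonoidClass.coe_pow, coe_rootHom, ← mul_pow, ZeroMemClass.coe_zero]
  rw [← sum_pow_char, pow_eq_zero_iff (Fact.out : p.Prime).ne_zero]

theorem closure_insert_range_rootHom (z : F) :
    Subfield.closure (insert ⟨z, Subfield.subset_closure (Or.inr rfl)⟩
      (Set.range (rootHom p z)) : Set (adjoin p ({z} : Set F))) = ⊤ := by
  have hinj : Function.Injective (Subfield.map (adjoin p ({z} : Set F)).subtype) :=
    fun S T h => SetLike.coe_injective (Subtype.val_injective.image_injective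
      (congrArg (fun U : Subfield F => (U : Set F)) h))
  refine hinj ?_
  rw [RingHom.map_field_closure, ← RingHom.fieldRange_eq_map, Subfield.fieldRange_subtype]
  conv_rhs => rw [adjoin]
  congr 1
  rw [Set.image_insert_eq, ← Set.range_comp]
  exact Set.union_singleton.symm

theorem WeakVishikEquiv.exists_sum_eq_zero {a : ι → F} {b : κ → F} (h : WeakVishikEquiv p a b)
    (z : F) (ha : ∃ e : ι → adjoin p ({z} : Set F), e ≠ 0 ∧ ∑ i, a i * (e i : F) = 0) :
    ∃ e : κ → adjoin p ({z} : Set F), e ≠ 0 ∧ ∑ i, b i * (e i : F) = 0 := by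
  obtain ⟨e, he0, he⟩ := ha
  have hd := h.2 (adjoin p ({z} : Set F)) (rootHom p z) ⟨z, Subfield.subset_closure (Or.inr rfl)⟩
    ⟨z, rfl⟩ (closure_insert_range_rootHom z)
  have hne : zeroSubmodule p (rootHom p z ∘ a) ≠ ⊥ :=
    (Submodule.ne_bot_iff _).2 ⟨e, mem_zeroSubmodule_rootHom.2 he, he0⟩
  have hne' : zeroSubmodule p (rootHom p z ∘ b) ≠ ⊥ := by
    intro hb
    refine hne (Submodule.finrank_eq_zero.1 ?_)
    rw [← Submodule.finrank_eq_zero] at hb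
    exact hd.trans hb
  obtain ⟨e', h1, h2⟩ := (Submodule.ne_bot_iff _).1 hne'
  exact ⟨e', h2, mem_zeroSubmodule_rootHom.1 h1⟩

theorem mem_adjoin_singleton {z x : F} (hx : x ∈ adjoin p ({z} : Set F)) :
    ∃ y : Fin p → F, x = ∑ j : Fin p, z ^ (j : ℕ) * y j ^ p := by
  have hp : p.Prime := Fact.out
  have hle : adjoin p ({z} : Set F) ≤ (pfisterField p ![z]).toSubfield := by
    refine adjoin_le (Set.singleton_subset_iff.2 ?_)
    exact Submodule.subset_span ⟨fun _ => ⟨1, hp.one_lt⟩, by simp [pfister]⟩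
  obtain ⟨y, rfl⟩ := mem_valueSpace.1 (hle hx)
  refine ⟨fun j => y fun _ => j, ?_⟩
  rw [eval, ← (Equiv.funUnique (Fin 1) (Fin p)).symm.sum_comp]
  refine Finset.sum_congr rfl fun j _ => ?_
  change (∏ i : Fin 1, ![z] i ^ (j : ℕ)) * y (fun _ => j) ^ p = _
  rw [Fin.prod_univ_one]
  rfl

/-- If an anisotropic form becomes isotropic over `F(z^{1/p})`, then `z` is in its norm field. -/
theorem mem_normField_of_sum_eq_zero {b : κ → F} (hb : Anisotropic p b) {z : F}
    {e : κ → adjoin p ({z} : Set F)} (he : e ≠ 0) (h : ∑ i, b i * (e i : F) = 0) :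
    z ∈ normField p b := by
  by_contra hz
  choose y hy using fun i => mem_adjoin_singleton (e i).2
  have hsum : ∑ j : Fin p, eval p b (fun i => y i j) * z ^ (j : ℕ) = 0 := by
    rw [← h]
    simp only [hy, eval, Finset.sum_mul, Finset.mul_sum]
    rw [Finset.sum_comm]
    exact Finset.sum_congr rfl fun i _ => Finset.sum_congr rfl fun j _ => by ring
  have hzero : ∀ j, eval p b (fun i => y i j) = 0 := by
    intro j
    by_contra hj
    have hli := linearIndependent_pow_of_notMem (N := normIntermediateField p b) hz
    have := Fintype.linearIndependent_iff.1 hli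
      (fun k => ⟨eval p b (fun i => y i k) / eval p b (fun i => y i j),
        div_mem_normField (mem_valueSpace.2 ⟨_, rfl⟩) (mem_valueSpace.2 ⟨_, rfl⟩)⟩)
      (by
        change ∑ k : Fin p, eval p b (fun i => y i k) / eval p b (fun i => y i j) * z ^ (k : ℕ) = 0
        simp only [div_mul_eq_mul_div]
        rw [← Finset.sum_div, hsum, zero_div]) j
    have := congrArg Subtype.val this
    exact one_ne_zero ((div_self hj).symm.trans this)
  refine he (funext fun i => Subtype.ext ?_)
  rw [hy]
  refine Finset.sum_eq_zero fun j _ => ?_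
  have := congrFun (hb.eq_zero (hzero j)) i
  simp only [Pi.zero_apply] at this
  rw [this, zero_pow (Fact.out : p.Prime).ne_zero, mul_zero]

theorem WeakVishikEquiv.symm {a : ι → F} {b : κ → F} (h : WeakVishikEquiv p a b) :
    WeakVishikEquiv p b a :=
  ⟨h.1.symm, fun E _ _ f α h1 h2 => (h.2 E f α h1 h2).symm⟩

theorem WeakVishikEquiv.normIntermediateField_le {a : ι → F} {b : κ → F}
    (h : WeakVishikEquiv p a b) (hb : Anisotropic p b) :
    normIntermediateField p a ≤ normIntermediateField p b := by
  have : ExpChar F p := .prime Fact.out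
  have hp : p.Prime := Fact.out
  refine normField_le fun u hu v hv hu0 hv0 => ?_
  obtain ⟨x, rfl⟩ := mem_valueSpace.1 hu
  obtain ⟨y, rfl⟩ := mem_valueSpace.1 hv
  set z := eval p a x / eval p a y with hz
  have hz1 : z ∈ adjoin p ({z} : Set F) := Subfield.subset_closure (Or.inr rfl)
  let e : ι → adjoin p ({z} : Set F) := fun i =>
    ⟨x i ^ p - z * y i ^ p,
      sub_mem (pow_mem_adjoin _ _) (mul_mem hz1 (pow_mem_adjoin _ _))⟩
  by_cases he : e = 0
  · have hy : ∃ i, y i ≠ 0 := by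
      by_contra! hy
      exact hv0 (by simp [eval, hy, hp.ne_zero])
    obtain ⟨i, hi⟩ := hy
    have h0 : x i ^ p - z * y i ^ p = 0 := congrArg Subtype.val (congrFun he i)
    have : z = (x i / y i) ^ p := by
      rw [div_pow, eq_div_iff (pow_ne_zero _ hi)]
      exact (sub_eq_zero.1 h0).symm
    rw [this]
    exact pow_mem_adjoin _ _
  · obtain ⟨e', he', hs⟩ := h.exists_sum_eq_zero z ⟨e, he, by
      change ∑ i, a i * (x i ^ p - z * y i ^ p) = 0
      have : ∑ i, a i * (x i ^ p - z * y i ^ p) = eval p a x - z * eval p a y := by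
        simp only [eval, Finset.mul_sum]
        rw [← Finset.sum_sub_distrib]
        exact Finset.sum_congr rfl fun i _ => by ring
      rw [this, hz, div_mul_cancel₀ _ hv0, sub_self]⟩
    exact mem_normField_of_sum_eq_zero hb he' hs

theorem WeakVishikEquiv.normIntermediateField_eq {a : ι → F} {b : κ → F}
    (h : WeakVishikEquiv p a b) (ha : Anisotropic p a) (hb : Anisotropic p b) :
    normIntermediateField p a = normIntermediateField p b :=
  le_antisymm (h.normIntermediateField_le hb) (h.symm.normIntermediateField_le ha)

theorem WeakVishikEquiv.normField_eq {a : ι → F} {b : κ → F}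
    (h : WeakVishikEquiv p a b) (ha : Anisotropic p a) (hb : Anisotropic p b) :
    normField p a = normField p b :=
  SetLike.ext fun x => by
    rw [← mem_normIntermediateField, h.normIntermediateField_eq ha hb, mem_normIntermediateField]

end

section Scaling

variable {K F : Type*} [Field K] [Field F] [Algebra K F]

/-- The preimage of a `K`-subspace of `F` under multiplication by `c`. -/
def scale (c : F) (V : Submodule K F) : Submodule K F := V.comap (LinearMap.mulLeft K c)

theorem mem_scale {c x : F} {V : Submodule K F} : x ∈ scale c V ↔ c * x ∈ V := Iff.rfl

theorem finrank_scale {c : F} (hc : c ≠ 0) (V : Submodule K F) :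
    Module.finrank K (scale c V) = Module.finrank K V :=
  LinearEquiv.finrank_eq
    { toFun := fun x => ⟨c * x, x.2⟩
      invFun := fun y => ⟨c⁻¹ * y, by rw [mem_scale, mul_inv_cancel_left₀ hc]; exact y.2⟩
      map_add' := fun x y => Subtype.ext (mul_add _ _ _)
      map_smul' := fun r x => Subtype.ext (mul_smul_comm _ _ _)
      left_inv := fun x => Subtype.ext (inv_mul_cancel_left₀ hc _)
      right_inv := fun y => Subtype.ext (mul_inv_cancel_left₀ hc _) }

/-- A hyperplane in a finite field extension is the kernel of a nonzero functional. -/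
theorem exists_dual_ker_eq {L : Type*} [Field L] [Algebra K L] [FiniteDimensional K L]
    {H : Submodule K L} (h : Module.finrank K H + 1 = Module.finrank K L) :
    ∃ f : Module.Dual K L, f ≠ 0 ∧ LinearMap.ker f = H := by
  have hlt : H < ⊤ := lt_top_iff_ne_top.2 fun ht => by
    rw [ht, finrank_top] at h
    omega
  obtain ⟨f, hf, hle⟩ := Submodule.exists_le_ker_of_lt_top H hlt
  refine ⟨f, hf, (Submodule.eq_of_le_of_finrank_eq hle ?_).symm⟩
  have := Module.Dual.finrank_ker_add_one_of_ne_zero hf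
  omega

/-- Any two hyperplanes in a finite field extension are scalings of each other. -/
theorem exists_mul_mem_iff_of_hyperplanes {L : Type*} [Field L] [Algebra K L]
    [FiniteDimensional K L] {H₁ H₂ : Submodule K L}
    (h₁ : Module.finrank K H₁ + 1 = Module.finrank K L)
    (h₂ : Module.finrank K H₂ + 1 = Module.finrank K L) :
    ∃ u : L, u ≠ 0 ∧ ∀ x, x ∈ H₁ ↔ u * x ∈ H₂ := by
  obtain ⟨f₁, hf₁, rfl⟩ := exists_dual_ker_eq h₁
  obtain ⟨f₂, hf₂, rfl⟩ := exists_dual_ker_eq h₂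
  let Φ : L →ₗ[K] Module.Dual K L :=
    (LinearMap.compRight K f₂).comp (LinearMap.mul K L)
  have hΦ : ∀ u x, Φ u x = f₂ (u * x) := fun u x => rfl
  have hinj : Function.Injective Φ := by
    rw [injective_iff_map_eq_zero]
    intro u hu
    by_contra hu0
    refine hf₂ (LinearMap.ext fun x => ?_)
    have := LinearMap.congr_fun hu (u⁻¹ * x)
    rwa [hΦ, mul_inv_cancel_left₀ hu0] at this
  have hsurj : Function.Surjective Φ :=
    (LinearMap.injective_iff_surjective_of_finrank_eq_finrank
      (Subspace.dual_finrank_eq (K := K) (V := L)).symm).1 hinj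
  obtain ⟨u, rfl⟩ := hsurj f₁
  refine ⟨u, ?_, fun x => Iff.rfl⟩
  rintro rfl
  exact hf₁ (map_zero Φ)

theorem exists_mul_mem_iff_of_finrank {L : IntermediateField K F} [FiniteDimensional K L]
    {V W : Submodule K F} (hV : V ≤ Subalgebra.toSubmodule L.toSubalgebra)
    (hW : W ≤ Subalgebra.toSubmodule L.toSubalgebra)
    (h₁ : Module.finrank K V + 1 = Module.finrank K L)
    (h₂ : Module.finrank K W + 1 = Module.finrank K L) :
    ∃ u : F, u ≠ 0 ∧ ∀ x, x ∈ V ↔ u * x ∈ W := by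
  let S := Subalgebra.toSubmodule L.toSubalgebra
  have e₁ : Module.finrank K (V.submoduleOf S) = Module.finrank K V :=
    (Submodule.submoduleOfEquivOfLe hV).finrank_eq
  have e₂ : Module.finrank K (W.submoduleOf S) = Module.finrank K W :=
    (Submodule.submoduleOfEquivOfLe hW).finrank_eq
  obtain ⟨u, hu, h⟩ := exists_mul_mem_iff_of_hyperplanes (K := K) (L := L)
    (H₁ := V.submoduleOf S) (H₂ := W.submoduleOf S) (by rw [← h₁, ← e₁]; rfl)
    (by rw [← h₂, ← e₂]; rfl)
  have hu' : (u : F) ≠ 0 := fun h0 => hu (Subtype.ext h0)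
  refine ⟨u, hu', fun x => ⟨fun hx => (h ⟨x, hV hx⟩).1 hx, fun hx => ?_⟩⟩
  have hxL : x ∈ L := by
    rw [← inv_mul_cancel_left₀ hu' x]
    exact mul_mem (inv_mem u.2) (hW hx)
  exact (h ⟨x, hxL⟩).2 hx

/-- A subspace of more than half the dimension of a finite field extension contains a
representation of every element as a quotient. -/
theorem exists_div_eq_of_finrank {L : IntermediateField K F} [FiniteDimensional K L]
    {V : Submodule K F} (hV : V ≤ Subalgebra.toSubmodule L.toSubalgebra)
    (h : Module.finrank K L < 2 * Module.finrank K V) {x : F} (hx : x ∈ L) :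
    ∃ u ∈ V, ∃ v ∈ V, x = u / v := by
  rcases eq_or_ne x 0 with rfl | hx0
  · exact ⟨0, zero_mem _, 0, zero_mem _, by simp⟩
  let S := Subalgebra.toSubmodule L.toSubalgebra
  have : FiniteDimensional K S := ‹FiniteDimensional K L›
  have : FiniteDimensional K V := Submodule.finiteDimensional_of_le hV
  have hV' : scale x V ≤ S := fun y hy => by
    change y ∈ L
    rw [← inv_mul_cancel_left₀ hx0 y]
    exact mul_mem (inv_mem hx) (hV hy)
  have : FiniteDimensional K (scale x V) := Submodule.finiteDimensional_of_le hV'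
  have hsum := Submodule.finrank_sup_add_finrank_inf_eq V (scale x V)
  have hle : Module.finrank K (V ⊔ scale x V : Submodule K F) ≤ Module.finrank K L :=
    Submodule.finrank_mono (sup_le hV hV')
  rw [finrank_scale hx0] at hsum
  have hne : V ⊓ scale x V ≠ ⊥ := fun hb => by
    rw [hb, finrank_bot] at hsum
    omega
  obtain ⟨v, hv, hv0⟩ := (Submodule.ne_bot_iff _).1 hne
  exact ⟨x * v, hv.2, v, hv.1, (mul_div_cancel_right₀ x hv0).symm⟩

end Scaling

section

variable {p : ℕ} [Fact p.Prime] {F : Type u} [Field F] [CharP F p]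
  {ι κ : Type*} [Fintype ι] [Fintype κ]

instance {n : ℕ} (b : Fin n → F) : FiniteDimensional (pthSubfield p F) (pfisterField p b) :=
  FiniteDimensional.span_of_finite _ (Set.finite_range (pfister p b))

theorem finrank_pfisterField {n : ℕ} {b : Fin n → F} (hb : Anisotropic p (pfister p b)) :
    Module.finrank (pthSubfield p F) (pfisterField p b) = p ^ n := by
  have := hb.finrank_valueSpace
  rw [Fintype.card_fun, Fintype.card_fin, Fintype.card_fin] at this
  exact this

theorem exists_ne_zero_mem_valueSpace {a : ι → F} (ha : Anisotropic p a)
    (h : Fintype.card ι ≠ 0) : ∃ v ∈ valueSpace p a, v ≠ 0 := by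
  refine (Submodule.ne_bot_iff _).1 fun hb => h ?_
  rw [← ha.finrank_valueSpace, hb, finrank_bot]

theorem scale_valueSpace_le {a : ι → F} {v : F} (hv : v ∈ valueSpace p a) (hv0 : v ≠ 0) :
    scale v (valueSpace p a) ≤
      Subalgebra.toSubmodule (normIntermediateField p a).toSubalgebra := fun x hx => by
  have := div_mem_normField (mem_scale.1 hx) hv
  rwa [mul_div_cancel_left₀ x hv0] at this

theorem similar_of_isQuasiPfister {a : ι → F} {b : κ → F} (ha : Anisotropic p a)
    (hb : Anisotropic p b) (hcard : Fintype.card ι = Fintype.card κ)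
    (hN : normIntermediateField p a = normIntermediateField p b) (h : IsQuasiPfister p a) :
    Similar p a b := by
  obtain ⟨k, c, -, hiso⟩ := h
  have hV : valueSpace p a = Subalgebra.toSubmodule (pfisterField p c).toSubalgebra := by
    refine SetLike.coe_injective ?_
    rw [coe_valueSpace, hiso.values_eq, ← coe_valueSpace]
    rfl
  have hNa : normIntermediateField p a = pfisterField p c := by
    rw [← Subalgebra.toSubmodule.injective.eq_iff.trans
      IntermediateField.toSubalgebra_injective.eq_iff] 
    refine le_antisymm (normField_le fun u hu v hv _ _ => ?_) fun x hx => ?_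
    · rw [hV] at hu hv
      exact div_mem hu hv
    · rw [← hV] at hx
      have := div_mem_normField hx (hV ▸ one_mem (pfisterField p c) : (1 : F) ∈ valueSpace p a)
      rwa [div_one] at this
  have hfin := ha.finrank_valueSpace
  have hne : Fintype.card κ ≠ 0 := by
    rw [← hcard, ← hfin, hV]
    exact (Module.finrank_pos (R := pthSubfield p F) (M := pfisterField p c)).ne'
  obtain ⟨w, hw, hw0⟩ := exists_ne_zero_mem_valueSpace hb hne
  have hle := scale_valueSpace_le hw hw0
  rw [← hN, hNa, ← hV] at hle
  have : FiniteDimensional (pthSubfield p F) (valueSpace p a) :=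
    FiniteDimensional.span_of_finite _ (Set.finite_range a)
  have heq := Submodule.eq_of_le_of_finrank_eq hle (by
    rw [finrank_scale hw0, hb.finrank_valueSpace, hfin, hcard])
  refine similar_of_valueSpace ha hb (inv_ne_zero hw0) fun x => ?_
  rw [← heq, mem_scale, inv_inv]

theorem similar_of_isQPNeighborCodimOne {a : ι → F} {b : κ → F} (ha : Anisotropic p a)
    (hb : Anisotropic p b) (hcard : Fintype.card ι = Fintype.card κ)
    (hN : normIntermediateField p a = normIntermediateField p b)
    (h : IsQPNeighborCodimOne p a) : Similar p a b := by
  have hp : p.Prime := Fact.out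
  obtain ⟨k, c, -, hc, ⟨d, hd0, ⟨T, -, hT⟩, hlt⟩, hdim⟩ := h
  rw [Fintype.card_fun, Fintype.card_fin, Fintype.card_fin] at hlt
  have hfin := finrank_pfisterField hc
  have hd0' := inv_ne_zero hd0
  have hV : scale d⁻¹ (valueSpace p a) ≤
      Subalgebra.toSubmodule (pfisterField p c).toSubalgebra := fun x hx => by
    obtain ⟨y, hy⟩ := mem_valueSpace.1 (mem_scale.1 hx)
    refine mem_valueSpace.2 ⟨T y, ?_⟩
    rw [← hT, eval_mul_left, hy, mul_inv_cancel_left₀ hd0]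
  have hfa := ha.finrank_valueSpace
  have hfa' := finrank_scale hd0' (valueSpace p a)
  have hge : 2 ≤ Fintype.card ι := by
    by_contra! hlt2
    have h2 : Fintype.card ι ≠ 0 := by
      intro h0
      rw [h0] at hlt
      omega
    have h1 : Fintype.card ι = 1 := by omega
    rw [h1] at hlt hdim
    have hk : k ≠ 0 := by
      rintro rfl
      simp at hdim
    have := Nat.le_self_pow hk p
    omega
  have hNa : normIntermediateField p a = pfisterField p c := by
    refine le_antisymm (normField_le fun u hu v hv _ _ => ?_) fun x hx => ?_
    · have key : ∀ w ∈ valueSpace p a, d * w ∈ pfisterField p c := fun w hw =>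
        hV (mem_scale.2 (by rwa [inv_mul_cancel_left₀ hd0]))
      rw [← mul_div_mul_left u v hd0]
      exact div_mem (key u hu) (key v hv)
    · obtain ⟨u, hu, v, hv, rfl⟩ := exists_div_eq_of_finrank hV (by omega) hx
      rw [← mul_div_mul_left u v hd0']
      exact div_mem_normField hu hv
  obtain ⟨w, hw, hw0⟩ := exists_ne_zero_mem_valueSpace hb (by omega)
  have hW := scale_valueSpace_le hw hw0
  rw [← hN, hNa] at hW
  obtain ⟨u, hu, h⟩ := exists_mul_mem_iff_of_finrank hV hW (by omega) (by
    rw [finrank_scale hw0, hb.finrank_valueSpace]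
    omega)
  refine similar_of_valueSpace ha hb
    (inv_ne_zero (mul_ne_zero (mul_ne_zero hw0 hu) hd0)) fun x => ?_
  have := h (d * x)
  rw [mem_scale, mem_scale, inv_mul_cancel_left₀ hd0] at this
  rw [this, inv_inv, mul_assoc, mul_assoc]

end

end QLF

/-- Let `φ`, `ψ` be weakly Vishik equivalent anisotropic
quasilinear `p`-forms. (i) If `φ` is minimal over `F` then so is `ψ`; (ii) if `φ`
is a quasi-Pfister form or a quasi-Pfister neighbor of codimension one, then `φ`
and `ψ` are similar. -/
theorem stmt_3 (p : ℕ) [Fact p.Prime] {F : Type u} [Field F] [CharP F p]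
    {n m : ℕ} (φ : Fin n → F) (ψ : Fin m → F)
    (hφ : QLF.Anisotropic p φ) (hψ : QLF.Anisotropic p ψ)
    (h : QLF.WeakVishikEquiv p φ ψ) :
    (QLF.Minimal p φ → QLF.Minimal p ψ) ∧
    ((QLF.IsQuasiPfister p φ ∨ QLF.IsQPNeighborCodimOne p φ) → QLF.Similar p φ ψ) := by
  have hN := h.normIntermediateField_eq hφ hψ
  refine ⟨fun hmin => ⟨hψ, ?_⟩, ?_⟩
  · rw [QLF.ndeg, ← h.normField_eq hφ hψ, ← h.1]
    exact hmin.2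
  · rintro (hq | hq)
    · exact QLF.similar_of_isQuasiPfister hφ hψ h.1 hN hq
    · exact QLF.similar_of_isQPNeighborCodimOne hφ hψ h.1 hN hq
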